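/- Let s ≥ 3 and let G be a graph with m edges, where m is sufficiently large (as a function of s). Set n = ⌊(1/(3s³))·(m/log m)^{(s+1)/(s+3)}⌋ and p = (1/(3s))·n^{−2/(s+1)}. Then there exists a graph Γ on n vertices such that: (i) every subgraph of the complete graph K_n isomorphic to G contains at least m·p/2 edges of Γ, and (ii) for every subgraph of K_n isomorphic to G, the maximum number of pairwise edge-disjoint s-cliques of Γ each sharing at least one edge with that subgraph is at most m·p/s². -/

import Mathlib

open SimpleGraph

/-- `G.ContainsCopy H` means the graph `G` contains a subgraph isomorphic to `H`,
i.e. there is an injective graph homomorphism from `H` into `G`. -/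
def SimpleGraph.ContainsCopy {α β : Type*} (G : SimpleGraph α) (H : SimpleGraph β) : Prop :=
  ∃ f : H →g G, Function.Injective f

/-- `RamseyProp n H G` : every graph `Γ` on `n` vertices contains a copy of `H`,
or its complement contains a copy of `G`. -/
def RamseyProp {α β : Type*} (n : ℕ) (H : SimpleGraph α) (G : SimpleGraph β) : Prop :=
  ∀ Γ : SimpleGraph (Fin n), Γ.ContainsCopy H ∨ Γᶜ.ContainsCopy G

/-- The Ramsey number `r(H, G)` : the least positive `n` such that every graph on `n`
vertices contains a copy of `H` or its complement contains a copy of `G`. -/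
noncomputable def ramseyNumber {α β : Type*} (H : SimpleGraph α) (G : SimpleGraph β) : ℕ :=
  sInf {n : ℕ | 0 < n ∧ RamseyProp n H G}

section BernoulliSubsets

variable {ι : Type*} [Fintype ι] [DecidableEq ι]

/-- The probability that a random subset of `ι`, containing each element independently with
probability `p`, equals `A`. -/
noncomputable def bernoulliWeight (p : ℝ) (A : Finset ι) : ℝ :=
  (∏ _i ∈ A, p) * ∏ _i ∈ Finset.univ \ A, (1 - p)

open Classical in
/-- The probability that a random subset of `ι`, containing each element independently with
probability `p`, satisfies `P`. -/
noncomputable def bernoulliProb (p : ℝ) (P : Finset ι → Prop) : ℝ :=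
  ∑ A : Finset ι with P A, bernoulliWeight p A

lemma bernoulliWeight_nonneg {p : ℝ} (hp₀ : 0 ≤ p) (hp₁ : p ≤ 1) (A : Finset ι) :
    0 ≤ bernoulliWeight p A :=
  mul_nonneg (Finset.prod_nonneg fun _ _ => hp₀) (Finset.prod_nonneg fun _ _ => sub_nonneg.2 hp₁)

lemma sum_bernoulliWeight (p : ℝ) : ∑ A : Finset ι, bernoulliWeight p A = 1 := by
  have h := Finset.prod_add (fun _ : ι => p) (fun _ => 1 - p) Finset.univ
  simp only [add_sub_cancel, Finset.prod_const_one, Finset.powerset_univ] at h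
  exact h.symm

lemma exists_of_bernoulliProb_lt_one {p : ℝ} {P : Finset ι → Prop}
    (h : bernoulliProb p P < 1) : ∃ A, ¬ P A := by
  by_contra! hP
  simp [bernoulliProb, hP, sum_bernoulliWeight] at h

lemma bernoulliProb_mono {p : ℝ} (hp₀ : 0 ≤ p) (hp₁ : p ≤ 1) {P Q : Finset ι → Prop}
    (h : ∀ A, P A → Q A) : bernoulliProb p P ≤ bernoulliProb p Q := by
  classical
  refine Finset.sum_le_sum_of_subset_of_nonneg (fun A hA => ?_)
    fun A _ _ => bernoulliWeight_nonneg hp₀ hp₁ A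
  simp only [Finset.mem_filter, Finset.mem_univ, true_and] at hA ⊢
  exact h A hA

lemma bernoulliProb_exists_le {p : ℝ} (hp₀ : 0 ≤ p) (hp₁ : p ≤ 1) {κ : Type*} (I : Finset κ)
    (P : κ → Finset ι → Prop) :
    bernoulliProb p (fun A => ∃ i ∈ I, P i A) ≤ ∑ i ∈ I, bernoulliProb p (P i) := by
  classical
  have h : ∀ A : Finset ι, (if ∃ i ∈ I, P i A then bernoulliWeight p A else 0) ≤
      ∑ i ∈ I, if P i A then bernoulliWeight p A else 0 := fun A => by
    have h0 : ∀ i ∈ I, 0 ≤ if P i A then bernoulliWeight p A else 0 := fun i _ => by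
      split_ifs
      exacts [bernoulliWeight_nonneg hp₀ hp₁ A, le_rfl]
    split_ifs with hA
    · obtain ⟨i, hi, hPi⟩ := hA
      exact (if_pos hPi).ge.trans (Finset.single_le_sum h0 hi)
    · exact Finset.sum_nonneg h0
  calc _ = ∑ A : Finset ι, if ∃ i ∈ I, P i A then bernoulliWeight p A else 0 := by
        rw [bernoulliProb, Finset.sum_filter]
        exact Finset.sum_congr rfl fun _ _ => by congr
    _ ≤ ∑ A : Finset ι, ∑ i ∈ I, if P i A then bernoulliWeight p A else 0 :=
        Finset.sum_le_sum fun A _ => h A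
    _ = _ := by
        rw [Finset.sum_comm]
        simp only [bernoulliProb, Finset.sum_filter]

lemma bernoulliProb_or_le {p : ℝ} (hp₀ : 0 ≤ p) (hp₁ : p ≤ 1) (P Q : Finset ι → Prop) :
    bernoulliProb p (fun A => P A ∨ Q A) ≤ bernoulliProb p P + bernoulliProb p Q := by
  have h := bernoulliProb_exists_le hp₀ hp₁ (Finset.univ : Finset Bool)
    fun b A => if b then P A else Q A
  simpa [or_comm, add_comm] using h

lemma bernoulliProb_superset (p : ℝ) (S : Finset ι) :
    bernoulliProb p (fun A => S ⊆ A) = p ^ S.card := by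
  classical
  have h := Finset.prod_add (fun _ : ι => p) (fun i => if i ∈ S then 0 else 1 - p) Finset.univ
  have h1 : ∏ i : ι, (p + if i ∈ S then 0 else 1 - p) = p ^ S.card := by
    have : ∀ i, (p + if i ∈ S then 0 else 1 - p) = if i ∈ S then p else 1 := fun i => by
      split_ifs <;> ring
    simp only [this, Finset.prod_ite_mem, Finset.univ_inter, Finset.prod_const]
  rw [h1, Finset.powerset_univ] at h
  rw [h, bernoulliProb, Finset.sum_filter]
  refine Finset.sum_congr rfl fun A _ => ?_
  split_ifs with hA
  · rw [bernoulliWeight]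
    congr 1
    refine Finset.prod_congr rfl fun i hi => (if_neg fun hiS => ?_).symm
    exact (Finset.mem_sdiff.1 hi).2 (hA hiS)
  · obtain ⟨i, hiS, hiA⟩ := Finset.not_subset.1 hA
    have hi : i ∈ Finset.univ \ A := by simp [hiA]
    have h0 : ∏ j ∈ Finset.univ \ A, (if j ∈ S then 0 else 1 - p) = 0 :=
      Finset.prod_eq_zero hi (if_pos hiS)
    rw [h0, mul_zero]

lemma sum_bernoulliWeight_mul_pow (p t : ℝ) (F : Finset ι) :
    ∑ A : Finset ι, bernoulliWeight p A * t ^ (F ∩ A).card = (1 - p + p * t) ^ F.card := by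
  have h := Finset.prod_add (fun i : ι => p * if i ∈ F then t else 1) (fun _ => 1 - p) Finset.univ
  have h1 : ∏ i : ι, ((p * if i ∈ F then t else 1) + (1 - p)) = (1 - p + p * t) ^ F.card := by
    have : ∀ i, ((p * if i ∈ F then t else 1) + (1 - p)) =
        if i ∈ F then 1 - p + p * t else 1 := fun i => by
      split_ifs <;> ring
    simp only [this, Finset.prod_ite_mem, Finset.univ_inter, Finset.prod_const]
  rw [h1, Finset.powerset_univ] at h
  rw [h]
  refine Finset.sum_congr rfl fun A _ => ?_
  rw [Finset.prod_mul_distrib, Finset.prod_ite_mem, Finset.prod_const t, bernoulliWeight,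
    Finset.inter_comm]
  ring

/-- A Chernoff bound for the lower tail of the binomial distribution. -/
lemma bernoulliProb_card_inter_lt_le {p : ℝ} (hp₀ : 0 ≤ p) (hp₁ : p ≤ 1) (F : Finset ι) :
    bernoulliProb p (fun A => ((F ∩ A).card : ℝ) < F.card * p / 2) ≤
      Real.exp (-(F.card * p / 9)) := by
  classical
  set c : ℝ := Real.exp (Real.log 2 * (F.card * p / 2)) with hc
  have hle : ∀ A : Finset ι, ((F ∩ A).card : ℝ) < F.card * p / 2 →
      1 ≤ (1 / 2 : ℝ) ^ (F ∩ A).card * c := fun A hA => by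
    have h2 : (1 / 2 : ℝ) ^ (F ∩ A).card = Real.exp (-(Real.log 2 * (F ∩ A).card)) := by
      rw [Real.exp_neg, Real.exp_mul, Real.exp_log two_pos, Real.rpow_natCast, one_div, inv_pow]
    rw [h2, hc, ← Real.exp_add]
    refine Real.one_le_exp ?_
    nlinarith [Real.log_pos one_lt_two]
  calc _ ≤ ∑ A : Finset ι with ((F ∩ A).card : ℝ) < F.card * p / 2,
          bernoulliWeight p A * ((1 / 2 : ℝ) ^ (F ∩ A).card * c) := by
        rw [bernoulliProb]
        refine (Finset.sum_le_sum fun A hA => ?_).trans_eq (Finset.sum_congr (by congr) fun _ _ => rfl)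
        exact le_mul_of_one_le_right (bernoulliWeight_nonneg hp₀ hp₁ A)
          (hle A (Finset.mem_filter.1 hA).2)
    _ ≤ ∑ A : Finset ι, bernoulliWeight p A * ((1 / 2 : ℝ) ^ (F ∩ A).card * c) :=
        Finset.sum_le_sum_of_subset_of_nonneg (Finset.filter_subset _ _) fun A _ _ =>
          mul_nonneg (bernoulliWeight_nonneg hp₀ hp₁ A) (by positivity)
    _ = (1 - p + p * (1 / 2)) ^ F.card * c := by
        rw [← sum_bernoulliWeight_mul_pow, Finset.sum_mul]
        simp only [mul_assoc]
    _ ≤ Real.exp (-(p / 2)) ^ F.card * c := by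
        gcongr ?_ ^ _ * c
        linarith [Real.add_one_le_exp (-(p / 2))]
    _ ≤ _ := by
        rw [← Real.exp_nat_mul, hc, ← Real.exp_add]
        refine Real.exp_le_exp.2 ?_
        have : 0 ≤ (F.card : ℝ) * p := by positivity
        nlinarith [Real.log_two_lt_d9]

end BernoulliSubsets

section CliquePacking

variable {V : Type*} [DecidableEq V]

/-- The edges of the complete graph on the vertex set `S`. -/
def cliqueEdges (S : Finset V) : Finset (Sym2 V) := S.offDiag.image Sym2.mk.uncurry

lemma mk_mem_cliqueEdges {S : Finset V} {x y : V} :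
    s(x, y) ∈ cliqueEdges S ↔ x ∈ S ∧ y ∈ S ∧ x ≠ y := by
  simp only [cliqueEdges, Finset.mem_image, Finset.mem_offDiag, Prod.exists, Function.uncurry]
  constructor
  · rintro ⟨a, b, ⟨ha, hb, hab⟩, h⟩
    rcases Sym2.eq_iff.1 h with ⟨rfl, rfl⟩ | ⟨rfl, rfl⟩
    exacts [⟨ha, hb, hab⟩, ⟨hb, ha, hab.symm⟩]
  · exact fun h => ⟨x, y, h, rfl⟩

lemma card_cliqueEdges (S : Finset V) : (cliqueEdges S).card = S.card.choose 2 :=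
  Sym2.card_image_offDiag S

lemma disjoint_cliqueEdges {S T : Finset V} (h : (S ∩ T).card ≤ 1) :
    Disjoint (cliqueEdges S) (cliqueEdges T) := by
  rw [Finset.disjoint_left]
  intro e
  induction e with | _ x y
  rw [mk_mem_cliqueEdges, mk_mem_cliqueEdges]
  rintro ⟨hxS, hyS, hxy⟩ ⟨hxT, hyT, -⟩
  exact hxy (Finset.card_le_one.1 h x (by simp [*]) y (by simp [*]))

lemma bernoulliProb_exists_packing_le [Fintype V] {p : ℝ} (hp₀ : 0 ≤ p) (hp₁ : p ≤ 1) {s : ℕ}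
    (Q : Finset (Finset V)) (hQ : ∀ S ∈ Q, S.card = s) (k : ℕ) :
    bernoulliProb p (fun A : Finset (Sym2 V) => ∃ 𝒞 ∈ Q.powersetCard k,
      (∀ S ∈ 𝒞, ∀ T ∈ 𝒞, S ≠ T → (S ∩ T).card ≤ 1) ∧ 𝒞.biUnion cliqueEdges ⊆ A) ≤
      Q.card.choose k * (p ^ s.choose 2) ^ k := by
  refine (bernoulliProb_exists_le hp₀ hp₁ _ _).trans ?_
  rw [← Finset.card_powersetCard, ← nsmul_eq_mul]
  refine Finset.sum_le_card_nsmul _ _ _ fun 𝒞 h𝒞 => ?_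
  obtain ⟨h𝒞Q, rfl⟩ := Finset.mem_powersetCard.1 h𝒞
  by_cases hd : ∀ S ∈ 𝒞, ∀ T ∈ 𝒞, S ≠ T → (S ∩ T).card ≤ 1
  · refine (bernoulliProb_mono hp₀ hp₁ fun A hA => hA.2).trans_eq ?_
    rw [bernoulliProb_superset, Finset.card_biUnion fun S hS T hT hST =>
        disjoint_cliqueEdges (hd S hS T hT hST),
      Finset.sum_congr rfl fun S hS => by rw [card_cliqueEdges, hQ S (h𝒞Q hS)],
      Finset.sum_const, smul_eq_mul, mul_comm, pow_mul]
  · simp only [hd, false_and, bernoulliProb, Finset.filter_false, Finset.sum_empty]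
    positivity

open Classical in
lemma card_filter_exists_edge_le [Fintype V] (F : Finset (Sym2 V)) (hF : ∀ e ∈ F, ¬ e.IsDiag)
    (t : ℕ) :
    (Finset.univ.filter fun S : Finset V => S.card = t + 2 ∧ ∃ e ∈ F, ∀ x ∈ e, x ∈ S).card ≤
      F.card * Fintype.card V ^ t := by
  calc _ ≤ (F.biUnion fun e => (Finset.univ.powersetCard t).image fun T => e.toFinset ∪ T).card := by
        refine Finset.card_le_card fun S hS => ?_
        obtain ⟨-, hS, e, he, heS⟩ := Finset.mem_filter.1 hS
        have hsub : e.toFinset ⊆ S := fun x hx => heS x (Sym2.mem_toFinset.1 hx)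
        refine Finset.mem_biUnion.2 ⟨e, he, Finset.mem_image.2 ⟨S \ e.toFinset, ?_, ?_⟩⟩
        · rw [Finset.mem_powersetCard]
          refine ⟨Finset.subset_univ _, ?_⟩
          rw [Finset.card_sdiff_of_subset hsub, Sym2.card_toFinset_of_not_isDiag e (hF e he), hS]
          rfl
        · exact Finset.union_sdiff_of_subset hsub
    _ ≤ F.card * Fintype.card V ^ t := by
        refine Finset.card_biUnion_le_card_mul _ _ _ fun e _ => ?_
        refine Finset.card_image_le.trans ?_
        rw [Finset.card_powersetCard, Finset.card_univ]
        exact Nat.choose_le_pow _ _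

end CliquePacking

lemma choose_mul_pow_le_exp_neg {N k : ℕ} {q : ℝ} (hq : 0 ≤ q) (h : N * q ≤ k / 9) :
    (N.choose k : ℝ) * q ^ k ≤ Real.exp (-k) := by
  have he : Real.exp 1 / 9 ≤ Real.exp (-1) := by
    have h1 := Real.exp_one_lt_d9
    have h0 := Real.exp_pos 1
    rw [Real.exp_neg, div_le_iff₀ (by norm_num), ← div_eq_inv_mul, le_div_iff₀ h0]
    nlinarith
  calc (N.choose k : ℝ) * q ^ k ≤ (N : ℝ) ^ k / k.factorial * q ^ k := by
        gcongr
        exact Nat.choose_le_pow_div k N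
    _ = (N * q) ^ k / k.factorial := by rw [mul_pow]; ring
    _ ≤ (k / 9 : ℝ) ^ k / k.factorial := by gcongr
    _ = (1 / 9 : ℝ) ^ k * ((k : ℝ) ^ k / k.factorial) := by rw [div_pow, div_pow]; ring
    _ ≤ (1 / 9 : ℝ) ^ k * Real.exp k := by
        gcongr
        exact Real.pow_div_factorial_le_exp _ k.cast_nonneg k
    _ = (Real.exp 1 / 9) ^ k := by
        rw [div_pow, div_pow, ← Real.exp_nat_mul, one_pow, mul_one]; ring
    _ ≤ Real.exp (-1) ^ k := by gcongr
    _ = Real.exp (-k) := by rw [← Real.exp_nat_mul]; ring_nf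

lemma pow_mul_edge_density_pow_le {s n : ℕ} (hs : 3 ≤ s) (hn : 1 ≤ n) {p : ℝ}
    (hp : p = (1 / (3 * (s : ℝ))) * (n : ℝ) ^ (-(2 : ℝ) / (s + 1))) :
    (n : ℝ) ^ (s - 2) * p ^ s.choose 2 ≤ p / (9 * (s : ℝ) ^ 2) := by
  have hn0 : (0 : ℝ) < n := by exact_mod_cast hn
  have hs0 : (3 : ℝ) ≤ s := by exact_mod_cast hs
  have hp0 : 0 < p := by rw [hp]; positivity
  obtain ⟨d, hd⟩ : ∃ d, s.choose 2 = d + 1 :=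
    ⟨s.choose 2 - 1, (Nat.sub_add_cancel (Nat.choose_pos (by lia))).symm⟩
  have hd' : (d : ℝ) = (s + 1) * (s - 2) / 2 := by
    have h := Nat.cast_choose_two ℝ s
    rw [hd] at h
    push_cast at h
    linarith
  have hd2 : 2 ≤ d := by
    have : (2 : ℝ) ≤ d := by rw [hd']; nlinarith
    exact_mod_cast this
  have hpow : ((n : ℝ) ^ (-(2 : ℝ) / (s + 1))) ^ d = ((n : ℝ) ^ (s - 2))⁻¹ := by
    rw [← Real.rpow_natCast, ← Real.rpow_mul hn0.le, ← Real.rpow_natCast (n : ℝ) (s - 2),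
      ← Real.rpow_neg hn0.le, hd', Nat.cast_sub (by lia)]
    congr 1
    field_simp
    push_cast
    ring
  have hcd : (1 / (3 * (s : ℝ))) ^ d ≤ (1 / (3 * (s : ℝ))) ^ 2 :=
    pow_le_pow_of_le_one (by positivity) (by rw [div_le_one (by positivity)]; linarith) hd2
  calc (n : ℝ) ^ (s - 2) * p ^ s.choose 2 = (n : ℝ) ^ (s - 2) * p ^ d * p := by
        rw [hd, pow_succ, mul_assoc]
    _ = (1 / (3 * (s : ℝ))) ^ d * p := by
        congr 1
        rw [hp, mul_pow, hpow]
        field_simp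
    _ ≤ (1 / (3 * (s : ℝ))) ^ 2 * p := by gcongr
    _ = p / (9 * (s : ℝ) ^ 2) := by
        field_simp
        norm_num

lemma mul_log_le_mul_edge_density_div {s m n : ℕ} (hs : 3 ≤ s) (hm : 3 ≤ m) (hn : 1 ≤ n)
    (hnm : (n : ℝ) ≤
      (1 / (3 * (s : ℝ) ^ 3)) * ((m : ℝ) / Real.log m) ^ ((s + 1 : ℝ) / (s + 3))) {p : ℝ}
    (hp : p = (1 / (3 * (s : ℝ))) * (n : ℝ) ^ (-(2 : ℝ) / (s + 1))) :
    n * Real.log m ≤ m * p / (s : ℝ) ^ 2 := by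
  have hn0 : (0 : ℝ) < n := by exact_mod_cast hn
  have hs0 : (3 : ℝ) ≤ s := by exact_mod_cast hs
  have hm0 : (3 : ℝ) ≤ m := by exact_mod_cast hm
  have hlog : 0 < Real.log m := Real.log_pos (by linarith)
  set c : ℝ := 1 / (3 * (s : ℝ) ^ 3) with hc
  have hc0 : 0 < c := by positivity
  have hc1 : c ≤ 1 := by
    rw [hc, div_le_one (by positivity)]
    nlinarith [pow_le_pow_left₀ (by norm_num) hs0 3]
  have hpow : (n : ℝ) * (n : ℝ) ^ ((2 : ℝ) / (s + 1)) ≤ c * (m / Real.log m) := by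
    have h := Real.rpow_le_rpow hn0.le hnm (z := ((s : ℝ) + 3) / (s + 1)) (by positivity)
    rw [Real.mul_rpow hc0.le (by positivity), ← Real.rpow_mul (by positivity)] at h
    have h1 : ((s : ℝ) + 1) / (s + 3) * ((s + 3) / (s + 1)) = 1 := by field_simp
    have h2 : ((s : ℝ) + 3) / (s + 1) = 1 + 2 / (s + 1) := by field_simp; ring
    rw [h1, Real.rpow_one] at h
    have h3 : c ^ (((s : ℝ) + 3) / (s + 1)) ≤ c := by
      conv_rhs => rw [← Real.rpow_one c]
      refine Real.rpow_le_rpow_of_exponent_ge hc0 hc1 ?_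
      rw [h2]
      have : (0 : ℝ) ≤ 2 / (s + 1) := by positivity
      linarith
    calc (n : ℝ) * (n : ℝ) ^ ((2 : ℝ) / (s + 1)) = (n : ℝ) ^ (((s : ℝ) + 3) / (s + 1)) := by
          rw [h2, Real.rpow_add hn0, Real.rpow_one]
      _ ≤ _ := h
      _ ≤ c * (m / Real.log m) := by gcongr
  have hneg : (n : ℝ) ^ (-(2 : ℝ) / (s + 1)) = ((n : ℝ) ^ ((2 : ℝ) / (s + 1)))⁻¹ := by
    rw [neg_div, Real.rpow_neg hn0.le]
  have hr : 0 < (n : ℝ) ^ ((2 : ℝ) / (s + 1)) := by positivity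
  have heq : (m : ℝ) * p / (s : ℝ) ^ 2 = c * m / (n : ℝ) ^ ((2 : ℝ) / (s + 1)) := by
    rw [hp, hneg, hc]
    field_simp
  rw [heq, le_div_iff₀ hr]
  rw [← mul_div_assoc, le_div_iff₀ hlog] at hpow
  linarith

lemma two_mul_lt_of_le_mul_rpow {s m n : ℕ} (hs : 3 ≤ s) (hm : 3 ≤ m)
    (hnm : (n : ℝ) ≤
      (1 / (3 * (s : ℝ) ^ 3)) * ((m : ℝ) / Real.log m) ^ ((s + 1 : ℝ) / (s + 3))) :
    2 * n < m := by
  have hs0 : (3 : ℝ) ≤ s := by exact_mod_cast hs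
  have hm0 : (3 : ℝ) ≤ m := by exact_mod_cast hm
  have hlog : 1 ≤ Real.log m := by
    rw [Real.le_log_iff_exp_le (by linarith)]
    linarith [Real.exp_one_lt_d9]
  have hlog' : Real.log m ≤ m := Real.log_le_self (by linarith)
  have h1 : ((m : ℝ) / Real.log m) ^ ((s + 1 : ℝ) / (s + 3)) ≤ m := by
    calc _ ≤ ((m : ℝ) / Real.log m) ^ (1 : ℝ) := by
          refine Real.rpow_le_rpow_of_exponent_le ?_ ?_
          · rw [le_div_iff₀ (by linarith)]; linarith
          · rw [div_le_one (by linarith)]; linarith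
      _ = m / Real.log m := Real.rpow_one _
      _ ≤ m := div_le_self (by linarith) hlog
  have h2 : 1 / (3 * (s : ℝ) ^ 3) ≤ 1 / 81 := by
    refine one_div_le_one_div_of_le (by norm_num) ?_
    nlinarith [pow_le_pow_left₀ (by norm_num) hs0 3]
  have h3 : (n : ℝ) ≤ 1 / 81 * m := hnm.trans (by gcongr)
  have : (2 * n : ℝ) < m := by linarith
  exact_mod_cast this

/-- For a fixed set `F` of edges of `K_n`, it is unlikely that `F` contains few random edges, or
that many edge-disjoint random `s`-cliques meet `F`. -/
lemma bernoulliProb_few_edges_or_packing_le {V : Type*} [Fintype V] [DecidableEq V] {s : ℕ}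
    (hs : 3 ≤ s) {p : ℝ} (hp₀ : 0 ≤ p) (hp₁ : p ≤ 1)
    (hnp : (Fintype.card V : ℝ) ^ (s - 2) * p ^ s.choose 2 ≤ p / (9 * (s : ℝ) ^ 2))
    (F : Finset (Sym2 V)) (hF : ∀ e ∈ F, ¬ e.IsDiag) :
    bernoulliProb p (fun A : Finset (Sym2 V) => ((F ∩ A).card : ℝ) < F.card * p / 2 ∨
      ∃ 𝒞 : Finset (Finset V),
        (∀ S ∈ 𝒞, S.card = s ∧ cliqueEdges S ⊆ A ∧ ∃ e ∈ F, ∀ x ∈ e, x ∈ S) ∧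
        (∀ S ∈ 𝒞, ∀ T ∈ 𝒞, S ≠ T → (S ∩ T).card ≤ 1) ∧
        F.card * p / (s : ℝ) ^ 2 < 𝒞.card) ≤
      2 * Real.exp (-(F.card * p / (s : ℝ) ^ 2)) := by
  classical
  have hs0 : (3 : ℝ) ≤ s := by exact_mod_cast hs
  set x : ℝ := F.card * p / (s : ℝ) ^ 2 with hx
  have hx0 : 0 ≤ x := by positivity
  set k := ⌊x⌋₊ + 1 with hk
  have hxk : x ≤ k := by rw [hk]; push_cast; exact (Nat.lt_floor_add_one x).le
  obtain ⟨t, rfl⟩ : ∃ t, s = t + 2 := ⟨s - 2, by lia⟩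
  set Q := Finset.univ.filter fun S : Finset V => S.card = t + 2 ∧ ∃ e ∈ F, ∀ x ∈ e, x ∈ S
  refine (bernoulliProb_or_le hp₀ hp₁ _ _).trans ?_
  rw [two_mul]
  refine add_le_add ?_ ?_
  · refine (bernoulliProb_card_inter_lt_le hp₀ hp₁ F).trans ?_
    rw [Real.exp_le_exp, neg_le_neg_iff, hx]
    gcongr
    nlinarith
  · calc _ ≤ bernoulliProb p (fun A : Finset (Sym2 V) => ∃ 𝒞 ∈ Q.powersetCard k,
          (∀ S ∈ 𝒞, ∀ T ∈ 𝒞, S ≠ T → (S ∩ T).card ≤ 1) ∧ 𝒞.biUnion cliqueEdges ⊆ A) := by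
          refine bernoulliProb_mono hp₀ hp₁ ?_
          rintro A ⟨𝒞, h𝒞, hd, hcard⟩
          obtain ⟨𝒟, h𝒟, h𝒟k⟩ := Finset.exists_subset_card_eq
            (Nat.succ_le_of_lt ((Nat.floor_lt hx0).2 hcard))
          refine ⟨𝒟, Finset.mem_powersetCard.2 ⟨fun S hS => ?_, h𝒟k⟩,
            fun S hS T hT => hd S (h𝒟 hS) T (h𝒟 hT),
            Finset.biUnion_subset.2 fun S hS => (h𝒞 S (h𝒟 hS)).2.1⟩
          have h := h𝒞 S (h𝒟 hS)
          exact Finset.mem_filter.2 ⟨Finset.mem_univ _, h.1, h.2.2⟩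
      _ ≤ Q.card.choose k * (p ^ (t + 2).choose 2) ^ k :=
          bernoulliProb_exists_packing_le hp₀ hp₁ Q (fun S hS => (Finset.mem_filter.1 hS).2.1) k
      _ ≤ Real.exp (-k) := by
          refine choose_mul_pow_le_exp_neg (by positivity) ?_
          have hQle : (Q.card : ℝ) ≤ F.card * (Fintype.card V : ℝ) ^ t := by
            exact_mod_cast card_filter_exists_edge_le F hF t
          calc (Q.card : ℝ) * p ^ (t + 2).choose 2
              ≤ F.card * (Fintype.card V : ℝ) ^ t * p ^ (t + 2).choose 2 := by gcongr
            _ = F.card * ((Fintype.card V : ℝ) ^ (t + 2 - 2) * p ^ (t + 2).choose 2) := by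
                rw [Nat.add_sub_cancel, mul_assoc]
            _ ≤ F.card * (p / (9 * ((t + 2 : ℕ) : ℝ) ^ 2)) := by gcongr
            _ = x / 9 := by rw [hx]; field_simp
            _ ≤ k / 9 := by gcongr
      _ ≤ Real.exp (-x) := Real.exp_le_exp.2 (neg_le_neg hxk)

theorem stmt_16 (s : ℕ) (hs : 3 ≤ s) :
    ∃ M : ℕ, ∀ (β : Type) [Fintype β] (G : SimpleGraph β) (m : ℕ),
      G.edgeSet.ncard = m → M ≤ m →
      ∀ n : ℕ, n = ⌊(1 / (3 * (s : ℝ) ^ 3)) * ((m : ℝ) / Real.log m) ^ ((s + 1 : ℝ) / (s + 3))⌋₊ →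
      ∀ p : ℝ, p = (1 / (3 * (s : ℝ))) * (n : ℝ) ^ (-(2 : ℝ) / (s + 1)) →
      ∃ Γ : SimpleGraph (Fin n),
        -- (i) every subgraph of `K_n` isomorphic to `G` contains at least `m·p/2` edges of `Γ`
        (∀ f : β → Fin n, Function.Injective f →
          (m : ℝ) * p / 2 ≤ (((Sym2.map f '' G.edgeSet) ∩ Γ.edgeSet).ncard : ℝ)) ∧
        -- (ii) every family of pairwise edge-disjoint `s`-cliques of `Γ`, each sharing an
        -- edge with the copy of `G`, has at most `m·p/s²` members
        (∀ f : β → Fin n, Function.Injective f →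
          ∀ 𝒞 : Finset (Finset (Fin n)),
            (∀ S ∈ 𝒞, Γ.IsNClique s S ∧ ∃ e ∈ Sym2.map f '' G.edgeSet, ∀ x ∈ e, x ∈ S) →
            (∀ S ∈ 𝒞, ∀ T ∈ 𝒞, S ≠ T → (S ∩ T).card ≤ 1) →
            (𝒞.card : ℝ) ≤ (m : ℝ) * p / (s : ℝ) ^ 2) := by
  classical
  refine ⟨3, fun β _ G m hGm hm n hn p hp => ?_⟩
  by_cases hinj : ∃ f : β → Fin n, Function.Injective f
  swap
  · push Not at hinj
    exact ⟨⊥, fun f hf => (hinj f hf).elim, fun f hf => (hinj f hf).elim⟩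
  obtain ⟨f₀, hf₀⟩ := hinj
  have hβn : Fintype.card β ≤ n := by simpa using Fintype.card_le_of_injective f₀ hf₀
  have hn1 : 1 ≤ n := by
    obtain ⟨e, -⟩ : G.edgeSet.Nonempty := Set.nonempty_of_ncard_ne_zero (by lia)
    induction e with | _ x y
    exact (Nat.zero_le _).trans_lt (f₀ x).isLt
  have hs0 : (3 : ℝ) ≤ s := by exact_mod_cast hs
  have hn0 : (1 : ℝ) ≤ n := by exact_mod_cast hn1
  have hm0 : (3 : ℝ) ≤ m := by exact_mod_cast hm
  have hnm : (n : ℝ) ≤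
      (1 / (3 * (s : ℝ) ^ 3)) * ((m : ℝ) / Real.log m) ^ ((s + 1 : ℝ) / (s + 3)) := by
    have hlog : 0 ≤ Real.log m := Real.log_nonneg (by linarith)
    rw [hn]
    exact Nat.floor_le (by positivity)
  have hp₀ : 0 ≤ p := by rw [hp]; positivity
  have hp₁ : p ≤ 1 := by
    rw [hp]
    refine mul_le_one₀ ?_ (by positivity) (Real.rpow_le_one_of_one_le_of_nonpos hn0 ?_)
    · rw [div_le_one (by positivity)]; linarith
    · exact div_nonpos_of_nonpos_of_nonneg (by norm_num) (by positivity)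
  set F : (β → Fin n) → Finset (Sym2 (Fin n)) := fun f => G.edgeFinset.image (Sym2.map f)
  have hFcoe : ∀ f, (F f : Set (Sym2 (Fin n))) = Sym2.map f '' G.edgeSet := fun f => by simp [F]
  have hFcard : ∀ f, Function.Injective f → (F f).card = m := fun f hf => by
    rw [← Set.ncard_coe_finset, hFcoe, Set.ncard_image_of_injective _ (Sym2.map.injective hf), hGm]
  have hFdiag : ∀ f, Function.Injective f → ∀ e ∈ F f, ¬ e.IsDiag := fun f hf e he => by
    obtain ⟨e', he', rfl⟩ := Finset.mem_image.1 he
    rw [Sym2.isDiag_map hf]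
    exact G.not_isDiag_of_mem_edgeFinset he'
  set bad : (β → Fin n) → Finset (Sym2 (Fin n)) → Prop := fun f A =>
    ((F f ∩ A).card : ℝ) < (F f).card * p / 2 ∨
      ∃ 𝒞 : Finset (Finset (Fin n)),
        (∀ S ∈ 𝒞, S.card = s ∧ cliqueEdges S ⊆ A ∧ ∃ e ∈ F f, ∀ x ∈ e, x ∈ S) ∧
        (∀ S ∈ 𝒞, ∀ T ∈ 𝒞, S ≠ T → (S ∩ T).card ≤ 1) ∧
        (F f).card * p / (s : ℝ) ^ 2 < 𝒞.card
  have hprob : bernoulliProb p (fun A => ∃ f ∈ Finset.univ.filter Function.Injective, bad f A) < 1 := by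
    have hnlog := mul_log_le_mul_edge_density_div hs hm hn1 hnm hp
    have hexp : Real.exp (-(m * p / (s : ℝ) ^ 2)) ≤ ((m : ℝ) ^ n)⁻¹ := by
      rw [Real.exp_neg]
      refine inv_anti₀ (by positivity) ?_
      rwa [← Real.log_le_iff_le_exp (by positivity), Real.log_pow]
    calc _ ≤ ∑ f ∈ Finset.univ.filter (Function.Injective : (β → Fin n) → Prop),
          bernoulliProb p (bad f) := bernoulliProb_exists_le hp₀ hp₁ _ _
      _ ≤ ∑ f ∈ Finset.univ.filter (Function.Injective : (β → Fin n) → Prop),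
          2 * ((m : ℝ) ^ n)⁻¹ := by
          refine Finset.sum_le_sum fun f hf => ?_
          have hf := (Finset.mem_filter.1 hf).2
          refine (bernoulliProb_few_edges_or_packing_le hs hp₀ hp₁ ?_ (F f) (hFdiag f hf)).trans ?_
          · rw [Fintype.card_fin]
            exact pow_mul_edge_density_pow_le hs hn1 hp
          · rw [hFcard f hf]
            gcongr
      _ ≤ (n : ℝ) ^ n * (2 * ((m : ℝ) ^ n)⁻¹) := by
          rw [Finset.sum_const, nsmul_eq_mul]
          gcongr
          have h : (Finset.univ.filter (Function.Injective : (β → Fin n) → Prop)).card ≤ n ^ n :=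
            (Finset.card_filter_le _ _).trans (by simpa using Nat.pow_le_pow_right hn1 hβn)
          exact_mod_cast h
      _ < 1 := by
          have h2n : (2 * n : ℝ) < m := by exact_mod_cast two_mul_lt_of_le_mul_rpow hs hm hnm
          rw [← mul_assoc, ← div_eq_mul_inv, div_lt_one (by positivity)]
          calc (n : ℝ) ^ n * 2 ≤ n ^ n * 2 ^ n := by
                gcongr
                exact le_self_pow₀ one_le_two (by lia)
            _ = (2 * n) ^ n := by rw [mul_pow, mul_comm]
            _ < (m : ℝ) ^ n := pow_lt_pow_left₀ h2n (by positivity) (by lia)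
  obtain ⟨A, hA⟩ := exists_of_bernoulliProb_lt_one hprob
  have hgood : ∀ f, Function.Injective f → ¬ bad f A := fun f hf hfA =>
    hA ⟨f, Finset.mem_filter.2 ⟨Finset.mem_univ _, hf⟩, hfA⟩
  refine ⟨SimpleGraph.fromEdgeSet A, fun f hf => ?_, fun f hf 𝒞 h𝒞 hd => ?_⟩
  · have h := not_lt.1 (not_or.1 (hgood f hf)).1
    rw [hFcard f hf] at h
    have heq : Sym2.map f '' G.edgeSet ∩ (SimpleGraph.fromEdgeSet (A : Set (Sym2 (Fin n)))).edgeSet =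
        ((F f ∩ A : Finset _) : Set (Sym2 (Fin n))) := by
      rw [Finset.coe_inter, ← hFcoe, SimpleGraph.edgeSet_fromEdgeSet]
      ext e
      have := hFdiag f hf e
      simp only [Set.mem_inter_iff, Set.mem_sdiff, Finset.mem_coe, Sym2.mem_diagSet]
      tauto
    rwa [heq, Set.ncard_coe_finset]
  · have h := (not_or.1 (hgood f hf)).2
    rw [hFcard f hf] at h
    refine not_lt.1 fun hlt => h ⟨𝒞, fun S hS => ?_, hd, hlt⟩
    obtain ⟨hclique, e, he, heS⟩ := h𝒞 S hS
    refine ⟨hclique.card_eq, fun e' he' => ?_, e, ?_, heS⟩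
    · induction e' with | _ x y
      obtain ⟨hx, hy, hxy⟩ := mk_mem_cliqueEdges.1 he'
      exact ((SimpleGraph.fromEdgeSet_adj _).1 (hclique.isClique hx hy hxy)).1
    · rwa [← Finset.mem_coe, hFcoe]
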